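/- arXiv:2310.10146 — 3 statements merged into one kernel-verified Lean document; each statement's English description precedes it below -/
import Mathlib

section
/- Let A be a real m₁×n matrix and B a real m₂×n matrix, let x ∈ ℝⁿ, u ∈ ℝ^{m₁}, v ∈ ℝ^{m₂}, and let c, s be real numbers with c² + s² = 1 such that A x = c·u, B x = s·v, and s·Aᵀu = c·Bᵀv. Then for all real numbers η, ξ, γ, ζ it holds that (γ c² + ζ s²)·(η AᵀA − ξ BᵀB) x = (η c² − ξ s²)·(γ AᵀA + ζ BᵀB) x; i.e., x is a generalized eigenvector of the parameterized pencil (η AᵀA − ξ BᵀB, γ AᵀA + ζ BᵀB) with generalized eigenvalue pair {η c² − ξ s², γ c² + ζ s²}. -/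
open Matrix

/-- A generalized singular quintuple `(c, s, u, v, x)` with
`c² + s² = 1` gives a generalized eigenvector `x` of the parameterized pencil
`(η AᵀA − ξ BᵀB, γ AᵀA + ζ BᵀB)` with eigenvalue pair `{η c² − ξ s², γ c² + ζ s²}`. -/
theorem gsvd_quintuple_parameterized_pencil {m₁ m₂ n : ℕ}
    (A : Matrix (Fin m₁) (Fin n) ℝ) (B : Matrix (Fin m₂) (Fin n) ℝ)
    (x : Fin n → ℝ) (u : Fin m₁ → ℝ) (v : Fin m₂ → ℝ) (c s : ℝ)
    (hcs : c ^ 2 + s ^ 2 = 1)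
    (h1 : A *ᵥ x = c • u) (h2 : B *ᵥ x = s • v)
    (h3 : s • (Aᵀ *ᵥ u) = c • (Bᵀ *ᵥ v)) :
    ∀ η ξ γ ζ : ℝ,
      (γ * c ^ 2 + ζ * s ^ 2) • ((η • (Aᵀ * A) - ξ • (Bᵀ * B)) *ᵥ x) =
        (η * c ^ 2 - ξ * s ^ 2) • ((γ • (Aᵀ * A) + ζ • (Bᵀ * B)) *ᵥ x) := by
  intro η ξ γ ζ
  have hA : (Aᵀ * A) *ᵥ x = c • (Aᵀ *ᵥ u) := by
    rw [← mulVec_mulVec, h1, mulVec_smul]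
  have hB : (Bᵀ * B) *ᵥ x = s • (Bᵀ *ᵥ v) := by
    rw [← mulVec_mulVec, h2, mulVec_smul]
  rw [sub_mulVec, add_mulVec, smul_mulVec, smul_mulVec, smul_mulVec, smul_mulVec, hA, hB]
  ext i
  have h := congrFun h3 i
  simp only [Pi.smul_apply, Pi.sub_apply, Pi.add_apply, smul_eq_mul] at h ⊢
  linear_combination (η * ζ + ξ * γ) * s * c * h
end

section
/- Let n ≥ 1, M ≥ 1, let P be an n×n real matrix with tr(P) > 0, let ε > 0 and 0 < δ < 1. For each sign pattern s : Fin M → Fin n → Bool define vectors zᵢ ∈ ℝⁿ by zᵢ(j) = 1 if s i j = true and zᵢ(j) = −1 otherwise, and set H_M(s) = (1/M)·Σ_{i=1}^{M} zᵢᵀ P zᵢ. If M ≥ 8 ε⁻² (‖P‖_F² + 2‖P‖·ε·tr(P)) · ln(2/δ) / tr(P)², then the number of sign patterns s for which |H_M(s) − tr(P)| ≥ ε·tr(P) is at most δ·2^{M·n}; that is, under the uniform probability on sign patterns (i.e., the entries of z₁,…,z_M are independent Rademacher variables), Pr(|H_M − tr(P)| ≥ ε·tr(P)) ≤ δ. 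-/
open Matrix

/-- The spectral norm (operator 2-norm) of a real matrix. -/
noncomputable def specNorm {m n : ℕ} (A : Matrix (Fin m) (Fin n) ℝ) : ℝ :=
  ‖LinearMap.toContinuousLinearMap (Matrix.toEuclideanLin A)‖

/-- The Frobenius norm of a real matrix. -/
noncomputable def frobNorm {m n : ℕ} (A : Matrix (Fin m) (Fin n) ℝ) : ℝ :=
  Real.sqrt (∑ i, ∑ j, A i j ^ 2)

/-- The Rademacher vector `z` associated with a sign pattern `s : Fin n → Bool`. -/
def radVec {n : ℕ} (s : Fin n → Bool) : Fin n → ℝ := fun j => if s j then 1 else -1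

/-- The Hutchinson trace estimator `H_M = (1/M) Σᵢ zᵢᵀ P zᵢ`. -/
noncomputable def hutchinson {n M : ℕ} (P : Matrix (Fin n) (Fin n) ℝ)
    (s : Fin M → Fin n → Bool) : ℝ :=
  (1 / (M : ℝ)) * ∑ i, radVec (s i) ⬝ᵥ (P *ᵥ radVec (s i))

theorem Real.exp_sub_sq_le {x : ℝ} (hx : 1 / 2 ≤ x) :
    Real.exp ((x - 1) - (x - 1) ^ 2) ≤ x := by
  have hx0 : 0 < x := by linarith
  rcases le_total 1 x with h1 | h1
  · rw [← Real.le_log_iff_exp_le hx0]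
    have h := Real.le_log_one_add_of_nonneg (x := x - 1) (by linarith)
    rw [add_sub_cancel] at h
    refine le_trans ?_ h
    rw [le_div_iff₀ (by linarith)]
    nlinarith [mul_nonneg (sub_nonneg.2 h1) (sub_nonneg.2 h1), pow_nonneg (sub_nonneg.2 h1) 3]
  · obtain ⟨u, rfl⟩ : ∃ u, x = 1 - u := ⟨1 - x, by ring⟩
    have hu0 : 0 ≤ u := by linarith
    have hu1 : u ≤ 1 / 2 := by linarith
    have h := Real.quadratic_le_exp_of_nonneg (x := u + u ^ 2) (by positivity)
    have hneg : (1 - u - 1) - (1 - u - 1) ^ 2 = -(u + u ^ 2) := by ring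
    rw [hneg, Real.exp_neg, inv_le_iff_one_le_mul₀ (Real.exp_pos _)]
    refine le_trans ?_ (mul_le_mul_of_nonneg_left h hx0.le)
    have h3 : 0 ≤ 1 - u - u ^ 2 - u ^ 3 := by
      nlinarith [mul_nonneg hu0 hu0, mul_nonneg hu0 (sub_nonneg.2 hu1)]
    nlinarith [mul_nonneg (mul_nonneg hu0 hu0) h3]

/-- Integrating a Rademacher quadratic form against the exponential is dominated by the
corresponding Gaussian integral when the diagonal of the form is nonnegative. -/
theorem sum_exp_neg_half_radVec_le {n : ℕ} (G : Matrix (Fin n) (Fin n) ℝ) (hG : G.IsSymm)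
    (hpos : ∀ v : Fin n → ℝ, v ≠ 0 → 0 < v ⬝ᵥ (G *ᵥ v)) (hdiag : ∀ i, G i i ≤ 1) :
    0 < G.det ∧
    ∑ s : Fin n → Bool, Real.exp (-(1 / 2) * (radVec s ⬝ᵥ (G *ᵥ radVec s))) ≤
      2 ^ n * Real.exp (-(n / 2 : ℝ)) / √G.det := by
  induction n with
  | zero => simp
  | succ n ih =>
    set a := G 0 0 with ha
    set b : Fin n → ℝ := fun i => G 0 i.succ with hb
    set T : Matrix (Fin n) (Fin n) ℝ := G.submatrix Fin.succ Fin.succ with hT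
    set S : Matrix (Fin n) (Fin n) ℝ := T - a⁻¹ • vecMulVec b b with hS
    have hquad : ∀ (x : ℝ) (v : Fin n → ℝ),
        (Fin.cons x v : Fin (n + 1) → ℝ) ⬝ᵥ (G *ᵥ Fin.cons x v) =
          a * x ^ 2 + 2 * x * (b ⬝ᵥ v) + v ⬝ᵥ (T *ᵥ v) := by
      intro x v
      have hsym : ∀ i : Fin n, G i.succ 0 = b i := fun i => hG.apply 0 i.succ
      simp only [dotProduct, mulVec, Fin.sum_univ_succ, Fin.cons_zero, Fin.cons_succ, hsym,
        mul_add, Finset.sum_add_distrib]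
      have : ∑ i, v i * (b i * x) = x * ∑ i, b i * v i := by
        rw [Finset.mul_sum]; exact Finset.sum_congr rfl fun i _ => by ring
      rw [this]
      simp only [hT, submatrix_apply, ← ha, hb]
      ring
    have hSquad : ∀ v : Fin n → ℝ, v ⬝ᵥ (S *ᵥ v) = v ⬝ᵥ (T *ᵥ v) - a⁻¹ * (b ⬝ᵥ v) ^ 2 := by
      intro v
      simp only [hS, sub_mulVec, dotProduct_sub, smul_mulVec, dotProduct_smul, vecMulVec_mulVec,
        smul_eq_mul, op_smul_eq_smul, dotProduct_comm v b]
      ring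
    have ha0 : 0 < a := by
      have := hpos (Fin.cons 1 0) (fun h => by simpa using congrFun h 0)
      rw [hquad] at this
      simpa using this
    have ha1 : a ≤ 1 := hdiag 0
    have hSpos : ∀ v : Fin n → ℝ, v ≠ 0 → 0 < v ⬝ᵥ (S *ᵥ v) := by
      intro v hv
      have := hpos (Fin.cons (-(a⁻¹ * (b ⬝ᵥ v))) v)
        (fun h => hv (by ext i; simpa using congrFun h i.succ))
      rw [hquad] at this
      rw [hSquad]
      convert this using 1
      field_simp
      ring
    have hSsymm : S.IsSymm := by
      ext i j
      have : T j i = T i j := hG.apply i.succ j.succ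
      simp [hS, vecMulVec_apply, this, mul_comm (b i)]
    have hSdiag : ∀ i, S i i ≤ 1 := by
      intro i
      have h1 : T i i ≤ 1 := hdiag i.succ
      have h2 : 0 ≤ a⁻¹ * (b i * b i) := mul_nonneg (inv_pos.2 ha0).le (mul_self_nonneg _)
      simp only [hS, Matrix.sub_apply, Matrix.smul_apply, vecMulVec_apply, smul_eq_mul]
      linarith
    obtain ⟨hdet, hsum⟩ := ih S hSsymm hSpos hSdiag
    have hdetG : G.det = a * S.det := by
      set c : Fin (n + 1) → ℝ := Fin.cons 0 fun i => a⁻¹ * b i with hc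
      have h := det_eq_of_forall_row_eq_smul_add_const (A := G)
        (B := Matrix.of fun i j => G i j - c i * G 0 j) c 0 (by simp [hc])
        (fun i j => by simp [hc])
      rw [h, det_succ_column_zero, Fin.sum_univ_succ, Finset.sum_eq_zero]
      · have : (Matrix.of fun i j => G i j - c i * G 0 j).submatrix (Fin.succAbove 0) Fin.succ
            = S := by
          ext i j
          simp [hS, hT, hc, hb, vecMulVec_apply, mul_assoc]
        rw [this]
        simp [hc, ha]
      · intro i _
        have hsym : G i.succ 0 = b i := hG.apply 0 i.succ
        have : a⁻¹ * b i * G 0 0 = b i := by rw [← ha]; field_simp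
        simp [hc, hsym, this]
    refine ⟨hdetG ▸ mul_pos ha0 hdet, ?_⟩
    have hcons : ∀ (t : Bool) (s : Fin n → Bool),
        radVec (Fin.cons t s : Fin (n + 1) → Bool) = Fin.cons (if t then 1 else -1) (radVec s) := by
      intro t s
      ext i
      refine Fin.cases ?_ (fun i => ?_) i <;> simp [radVec]
    have hstep : ∀ s : Fin n → Bool,
        ∑ t : Bool, Real.exp (-(1 / 2) * (radVec (Fin.cons t s : Fin (n + 1) → Bool) ⬝ᵥ
          (G *ᵥ radVec (Fin.cons t s : Fin (n + 1) → Bool)))) ≤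
        2 * Real.exp (-(a / 2)) * Real.exp (-(1 / 2) * (radVec s ⬝ᵥ (S *ᵥ radVec s))) := by
      intro s
      simp only [hcons, hquad, hSquad, Fintype.sum_bool]
      set q := radVec s ⬝ᵥ (T *ᵥ radVec s)
      set β := b ⬝ᵥ radVec s
      have hβ : β ^ 2 / 2 ≤ a⁻¹ * β ^ 2 / 2 := by
        have := one_le_inv₀ ha0 |>.2 ha1
        nlinarith [sq_nonneg β]
      have hcosh := (Real.cosh_le_exp_half_sq β).trans (Real.exp_le_exp.2 hβ)
      rw [Real.cosh_eq] at hcosh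
      calc _ = Real.exp (-(a / 2)) * Real.exp (-(1 / 2) * q) * (Real.exp β + Real.exp (-β)) := by
            rw [← Real.exp_add, mul_add (Real.exp _), ← Real.exp_add, ← Real.exp_add, add_comm]
            simp only [if_true, Bool.false_eq_true, if_false]
            congr 2 <;> ring
        _ ≤ Real.exp (-(a / 2)) * Real.exp (-(1 / 2) * q) * (2 * Real.exp (a⁻¹ * β ^ 2 / 2)) := by
            gcongr
            linarith
        _ = _ := by
            rw [show -(1 / 2) * (q - a⁻¹ * β ^ 2) = -(1 / 2) * q + a⁻¹ * β ^ 2 / 2 by ring,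
              Real.exp_add]
            ring
    have hsqrt : Real.exp (-(a / 2)) ≤ Real.exp (-(1 / 2)) / √a := by
      rw [le_div_iff₀ (Real.sqrt_pos.2 ha0)]
      have h1 : √a ≤ Real.exp ((a - 1) / 2) := by
        rw [Real.sqrt_le_left (Real.exp_pos _).le, ← Real.exp_nat_mul]
        have := Real.add_one_le_exp (a - 1)
        convert this using 1 <;> [ring; skip]
        congr 1
        push_cast
        ring
      refine (mul_le_mul_of_nonneg_left h1 (Real.exp_pos _).le).trans_eq ?_
      rw [← Real.exp_add]
      congr 1
      ring
    rw [← (Fin.consEquiv fun _ => Bool).sum_comp, Fintype.sum_prod_type_right]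
    calc _ ≤ ∑ s : Fin n → Bool,
          2 * Real.exp (-(a / 2)) * Real.exp (-(1 / 2) * (radVec s ⬝ᵥ (S *ᵥ radVec s))) :=
          Finset.sum_le_sum fun s _ => hstep s
      _ = 2 * Real.exp (-(a / 2)) *
          ∑ s : Fin n → Bool, Real.exp (-(1 / 2) * (radVec s ⬝ᵥ (S *ᵥ radVec s))) := by
          rw [Finset.mul_sum]
      _ ≤ 2 * (Real.exp (-(1 / 2)) / √a) * (2 ^ n * Real.exp (-(n / 2 : ℝ)) / √S.det) := by
          gcongr
      _ = _ := by
          rw [hdetG, Real.sqrt_mul ha0.le, pow_succ]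
          have : Real.exp (-((n + 1 : ℕ) / 2 : ℝ)) =
              Real.exp (-(1 / 2)) * Real.exp (-(n / 2 : ℝ)) := by
            rw [← Real.exp_add]
            congr 1
            push_cast
            ring
          rw [this]
          field_simp

theorem Matrix.IsHermitian.trace_mul_self_eq_sum_eigenvalues {n : ℕ}
    {G : Matrix (Fin n) (Fin n) ℝ} (hG : G.IsHermitian) :
    (G * G).trace = ∑ i, hG.eigenvalues i ^ 2 := by
  conv_lhs => rw [hG.spectral_theorem, ← map_mul, Unitary.conjStarAlgAut_apply, trace_mul_cycle]
  simp [Matrix.diagonal_mul_diagonal, Matrix.trace, sq]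

theorem Matrix.IsHermitian.exp_trace_le_det {n : ℕ} {G : Matrix (Fin n) (Fin n) ℝ}
    (hG : G.IsHermitian) (h : ∀ v : Fin n → ℝ, 1 / 2 * (v ⬝ᵥ v) ≤ v ⬝ᵥ (G *ᵥ v)) :
    Real.exp ((G - 1).trace - ((G - 1) * (G - 1)).trace) ≤ G.det := by
  have hμ : ∀ i, 1 / 2 ≤ hG.eigenvalues i := fun i => by
    have h1 : (hG.eigenvectorBasis i).ofLp ⬝ᵥ (hG.eigenvectorBasis i).ofLp = 1 := by
      have := hG.eigenvectorBasis.orthonormal.1 i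
      have h2 := EuclideanSpace.real_norm_sq_eq (hG.eigenvectorBasis i)
      rw [this] at h2
      simp only [dotProduct, ← sq]
      linarith
    have := h (hG.eigenvectorBasis i).ofLp
    rw [hG.eigenvalues_eq]
    simpa [h1] using this
  have hexp : (G - 1).trace - ((G - 1) * (G - 1)).trace =
      ∑ i, ((hG.eigenvalues i - 1) - (hG.eigenvalues i - 1) ^ 2) := by
    have h1 := hG.trace_eq_sum_eigenvalues
    have h2 := hG.trace_mul_self_eq_sum_eigenvalues
    simp only [RCLike.ofReal_real_eq_id, id] at h1
    simp only [sub_mul, mul_sub, one_mul, mul_one, trace_sub, trace_one, h2, h1, sub_sq,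
      Finset.sum_sub_distrib, Finset.sum_add_distrib, ← Finset.mul_sum]
    simp
    ring
  have hdet : G.det = ∏ i, hG.eigenvalues i := by
    simpa using hG.det_eq_prod_eigenvalues
  rw [hexp, Real.exp_sum, hdet]
  exact Finset.prod_le_prod (fun i _ => (Real.exp_pos _).le) fun i _ => Real.exp_sub_sq_le (hμ i)

theorem sum_exp_radVec_sub_trace_le {n : ℕ} (P : Matrix (Fin n) (Fin n) ℝ) {p l : ℝ}
    (hp : ∀ v : Fin n → ℝ, |v ⬝ᵥ (P *ᵥ v)| ≤ p * (v ⬝ᵥ v)) (hl : 0 ≤ l) (hlp : l * p ≤ 1 / 8) :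
    ∑ s : Fin n → Bool, Real.exp (l * (radVec s ⬝ᵥ (P *ᵥ radVec s) - P.trace)) ≤
      2 ^ n * Real.exp (2 * l ^ 2 * ∑ i, ∑ j, P i j ^ 2) := by
  set N : Matrix (Fin n) (Fin n) ℝ := P + Pᵀ - (2 : ℝ) • diagonal P.diag with hN
  set G : Matrix (Fin n) (Fin n) ℝ := 1 - l • N with hG
  have hNsymm : N.IsSymm := by
    ext i j
    by_cases h : i = j
    · simp [h]
    · simp [hN, h, Ne.symm h, add_comm]
  have hNdiag : ∀ i, N i i = 0 := fun i => by simp [hN]; ring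
  have hGsymm : G.IsSymm := by
    rw [IsSymm, hG, transpose_sub, transpose_one, transpose_smul, hNsymm]
  have hquad : ∀ v : Fin n → ℝ, v ⬝ᵥ (G *ᵥ v) =
      v ⬝ᵥ v - 2 * l * (v ⬝ᵥ (P *ᵥ v) - ∑ i, P i i * v i ^ 2) := by
    intro v
    have h1 : v ⬝ᵥ (Pᵀ *ᵥ v) = v ⬝ᵥ (P *ᵥ v) := by
      rw [mulVec_transpose, dotProduct_comm, dotProduct_mulVec]
    have h2 : v ⬝ᵥ (diagonal P.diag *ᵥ v) = ∑ i, P i i * v i ^ 2 := by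
      simp only [dotProduct, mulVec_diagonal, diag_apply]
      exact Finset.sum_congr rfl fun i _ => by ring
    simp only [hG, hN, sub_mulVec, add_mulVec, smul_mulVec, one_mulVec, dotProduct_sub,
      dotProduct_add, dotProduct_smul, smul_eq_mul, h1, h2]
    ring
  have hdiagP : ∀ i, -p ≤ P i i := fun i => by
    have := hp (Pi.single i 1)
    simp at this
    exact (abs_le.1 this).1
  have hlower : ∀ v : Fin n → ℝ, 1 / 2 * (v ⬝ᵥ v) ≤ v ⬝ᵥ (G *ᵥ v) := by
    intro v
    have hv : 0 ≤ v ⬝ᵥ v := by simpa using dotProduct_star_self_nonneg v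
    have h1 := (abs_le.1 (hp v)).2
    have h2 : -p * (v ⬝ᵥ v) ≤ ∑ i, P i i * v i ^ 2 := by
      rw [dotProduct, Finset.mul_sum]
      exact Finset.sum_le_sum fun i _ => by
        nlinarith [mul_le_mul_of_nonneg_right (hdiagP i) (sq_nonneg (v i))]
    have h3 : l * (v ⬝ᵥ (P *ᵥ v) - ∑ i, P i i * v i ^ 2) ≤ l * (2 * p * (v ⬝ᵥ v)) :=
      mul_le_mul_of_nonneg_left (by linarith) hl
    have h4 := mul_le_mul_of_nonneg_right hlp hv
    rw [hquad]
    linarith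
  have hGpos : ∀ v : Fin n → ℝ, v ≠ 0 → 0 < v ⬝ᵥ (G *ᵥ v) := by
    intro v hv
    have : 0 < v ⬝ᵥ v := by simpa using dotProduct_star_self_pos_iff.2 hv
    linarith [hlower v]
  obtain ⟨hdet, hsum⟩ := sum_exp_neg_half_radVec_le G hGsymm hGpos fun i => by
    simp [hG, hNdiag]
  have hGherm : G.IsHermitian := by
    rw [IsHermitian, conjTranspose_eq_transpose_of_trivial, hGsymm]
  have hfrob : (N * N).trace ≤ 4 * ∑ i, ∑ j, P i j ^ 2 := by
    have h1 : (N * N).trace ≤ ∑ i, ∑ j, (2 * P i j ^ 2 + 2 * P j i ^ 2) := by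
      simp only [Matrix.trace, diag_apply, mul_apply]
      refine Finset.sum_le_sum fun i _ => Finset.sum_le_sum fun j _ => ?_
      rw [hNsymm.apply i j]
      by_cases h : i = j
      · subst h
        rw [hNdiag, zero_mul]
        positivity
      · have : N i j = P i j + P j i := by simp [hN, h]
        rw [this]
        nlinarith [sq_nonneg (P i j - P j i)]
    refine h1.trans_eq ?_
    simp only [Finset.sum_add_distrib, ← Finset.mul_sum]
    rw [Finset.sum_comm (f := fun i j => P j i ^ 2)]
    ring
  have hdetle : Real.exp (-(2 * l ^ 2 * ∑ i, ∑ j, P i j ^ 2)) ≤ √G.det := by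
    refine Real.le_sqrt_of_sq_le (le_trans ?_ (hGherm.exp_trace_le_det hlower))
    have h1 : G - 1 = -(l • N) := by rw [hG]; abel
    have h2 : N.trace = 0 := by simp [Matrix.trace, hNdiag]
    rw [← Real.exp_nat_mul, Real.exp_le_exp, h1]
    simp only [trace_neg, trace_smul, h2, neg_mul_neg, smul_mul_smul_comm, smul_eq_mul]
    push_cast
    nlinarith [mul_le_mul_of_nonneg_left hfrob (mul_nonneg hl hl)]
  have hz : ∀ s : Fin n → Bool, Real.exp (l * (radVec s ⬝ᵥ (P *ᵥ radVec s) - P.trace)) =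
      Real.exp (n / 2 : ℝ) * Real.exp (-(1 / 2) * (radVec s ⬝ᵥ (G *ᵥ radVec s))) := by
    intro s
    have h1 : ∀ i, radVec s i ^ 2 = 1 := fun i => by
      unfold radVec; split_ifs <;> norm_num
    have h2 : radVec s ⬝ᵥ radVec s = n := by simp [dotProduct, ← sq, h1]
    rw [← Real.exp_add, hquad, h2]
    simp only [h1, mul_one, Matrix.trace, diag_apply]
    congr 1
    ring
  simp only [hz, ← Finset.mul_sum]
  calc _ ≤ Real.exp (n / 2 : ℝ) * (2 ^ n * Real.exp (-(n / 2 : ℝ)) / √G.det) := by gcongr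
    _ = 2 ^ n / √G.det := by rw [Real.exp_neg]; field_simp
    _ ≤ 2 ^ n / Real.exp (-(2 * l ^ 2 * ∑ i, ∑ j, P i j ^ 2)) := by gcongr
    _ = _ := by rw [Real.exp_neg, div_inv_eq_mul]

/-- Chernoff bound for the upper tail of a sum of independent Rademacher quadratic forms. -/
theorem card_le_sum_radVec_sub_trace {n M : ℕ} (P : Matrix (Fin n) (Fin n) ℝ) {p t L : ℝ}
    (hp : ∀ v : Fin n → ℝ, |v ⬝ᵥ (P *ᵥ v)| ≤ p * (v ⬝ᵥ v)) (hp0 : 0 ≤ p) (ht : 0 < t)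
    (hD : 0 < ∑ i, ∑ j, P i j ^ 2 + 2 * p * t)
    (hM : 8 * (∑ i, ∑ j, P i j ^ 2 + 2 * p * t) * L / t ^ 2 ≤ M) :
    (Nat.card {s : Fin M → Fin n → Bool //
        M * t ≤ ∑ i, (radVec (s i) ⬝ᵥ (P *ᵥ radVec (s i)) - P.trace)} : ℝ) ≤
      Real.exp (-L) * 2 ^ (M * n) := by
  classical
  set F := ∑ i, ∑ j, P i j ^ 2 with hF
  set D := F + 2 * p * t with hDdef
  have hF0 : 0 ≤ F := by positivity
  set l := t / (4 * D) with hl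
  have hl0 : 0 ≤ l := by positivity
  have hlp : l * p ≤ 1 / 8 := by
    rw [hl, div_mul_eq_mul_div, div_le_iff₀ (by positivity)]
    linarith
  set X : (Fin n → Bool) → ℝ := fun s => radVec s ⬝ᵥ (P *ᵥ radVec s) - P.trace with hX
  have hmgf : ∑ s, Real.exp (l * X s) ≤ 2 ^ n * Real.exp (2 * l ^ 2 * F) :=
    sum_exp_radVec_sub_trace_le P hp hl0 hlp
  have hexp : (M : ℝ) * (2 * l ^ 2 * F) - l * (M * t) ≤ -L := by
    have h1 : 2 * l ^ 2 * F - l * t ≤ -(t ^ 2 / (8 * D)) := by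
      have h2 : 2 * l ^ 2 * F ≤ 2 * l ^ 2 * D := by
        gcongr
        have : 0 ≤ p * t := by positivity
        linarith
      have h3 : 2 * l ^ 2 * D - l * t = -(t ^ 2 / (8 * D)) := by
        rw [hl]; field_simp; ring
      linarith
    have h4 : L ≤ M * (t ^ 2 / (8 * D)) := by
      rw [div_le_iff₀ (by positivity)] at hM
      rw [← mul_div_assoc, le_div_iff₀ (by positivity)]
      linarith
    have h5 := mul_le_mul_of_nonneg_left h1 (Nat.cast_nonneg (α := ℝ) M)
    linarith
  rw [Nat.card_eq_fintype_card, Fintype.card_subtype, Finset.card_filter, Nat.cast_sum]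
  calc _ ≤ ∑ s : Fin M → Fin n → Bool,
        Real.exp (-(l * (M * t))) * ∏ i, Real.exp (l * X (s i)) := by
        refine Finset.sum_le_sum fun s _ => ?_
        rw [← Real.exp_sum, ← Finset.mul_sum, ← Real.exp_add]
        split_ifs with h
        · rw [Nat.cast_one, Real.one_le_exp_iff]
          linarith [mul_le_mul_of_nonneg_left h hl0]
        · simpa using (Real.exp_pos _).le
    _ = Real.exp (-(l * (M * t))) * (∑ s, Real.exp (l * X s)) ^ M := by
        rw [← Finset.mul_sum, ← Fintype.piFinset_univ,
          ← Finset.prod_univ_sum (fun _ => Finset.univ) (fun _ s => Real.exp (l * X s))]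
        simp
    _ ≤ Real.exp (-(l * (M * t))) * (2 ^ n * Real.exp (2 * l ^ 2 * F)) ^ M := by
        gcongr
    _ = Real.exp ((M : ℝ) * (2 * l ^ 2 * F) - l * (M * t)) * 2 ^ (M * n) := by
        rw [mul_pow, ← Real.exp_nat_mul, ← pow_mul, mul_comm n M, sub_eq_add_neg, Real.exp_add]
        ring
    _ ≤ _ := by gcongr

theorem abs_dotProduct_mulVec_le_specNorm {n : ℕ} (P : Matrix (Fin n) (Fin n) ℝ)
    (v : Fin n → ℝ) : |v ⬝ᵥ (P *ᵥ v)| ≤ specNorm P * (v ⬝ᵥ v) := by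
  set T := LinearMap.toContinuousLinearMap (Matrix.toEuclideanLin P)
  set x : EuclideanSpace ℝ (Fin n) := WithLp.toLp 2 v
  have h1 : v ⬝ᵥ (P *ᵥ v) = inner ℝ (T x) x := by
    simp [T, x, EuclideanSpace.inner_eq_star_dotProduct]
  have h2 : v ⬝ᵥ v = ‖x‖ * ‖x‖ := by
    rw [← sq, EuclideanSpace.real_norm_sq_eq]
    simp [x, dotProduct, sq]
  rw [h1, h2]
  calc _ ≤ ‖T x‖ * ‖x‖ := abs_real_inner_le_norm _ _
    _ ≤ (‖T‖ * ‖x‖) * ‖x‖ := by gcongr; exact T.le_opNorm x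
    _ = _ := by rw [mul_assoc]; rfl

/-- With `z₁, …, z_M` independent Rademacher vectors (uniform sign
patterns), if `M ≥ 8 ε⁻² (‖P‖_F² + 2 ‖P‖ ε tr(P)) ln(2/δ) / tr(P)²`, then
`Pr(|H_M − tr(P)| ≥ ε tr(P)) ≤ δ`, i.e. the number of sign patterns for which
`|H_M − tr(P)| ≥ ε tr(P)` is at most `δ · 2^{M n}`. -/
theorem hutchinson_trace_estimate {n M : ℕ} (hn : 1 ≤ n) (hM : 1 ≤ M)
    (P : Matrix (Fin n) (Fin n) ℝ) (htr : 0 < P.trace)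
    (ε δ : ℝ) (hε : 0 < ε) (hδ0 : 0 < δ) (hδ1 : δ < 1)
    (hMbig : (M : ℝ) ≥
      8 * ε⁻¹ ^ 2 * (frobNorm P ^ 2 + 2 * specNorm P * ε * P.trace) *
        Real.log (2 / δ) / P.trace ^ 2) :
    (Nat.card {s : Fin M → Fin n → Bool //
        ε * P.trace ≤ |hutchinson P s - P.trace|} : ℝ) ≤ δ * 2 ^ (M * n) := by
  classical
  set t := ε * P.trace with ht
  have ht0 : 0 < t := mul_pos hε htr
  set F := ∑ i, ∑ j, P i j ^ 2 with hF
  have hM0 : (0 : ℝ) < M := by exact_mod_cast hM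
  have hp0 : 0 ≤ specNorm P := norm_nonneg _
  have hfrob : frobNorm P ^ 2 = F := Real.sq_sqrt (by positivity)
  have hF0 : 0 < F := by
    refine lt_of_le_of_ne (by positivity) fun h => htr.ne' ?_
    rw [hF, eq_comm, Finset.sum_eq_zero_iff_of_nonneg (fun _ _ => by positivity)] at h
    refine Finset.sum_eq_zero fun i hi => ?_
    have := h i hi
    rw [Finset.sum_eq_zero_iff_of_nonneg (fun _ _ => by positivity)] at this
    simpa using this i hi
  have hD : 0 < F + 2 * specNorm P * t := by positivity
  have hbound : 8 * (F + 2 * specNorm P * t) * Real.log (2 / δ) / t ^ 2 ≤ M := by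
    refine le_trans (le_of_eq ?_) hMbig
    rw [hfrob, ht]
    field_simp
  have hexp : Real.exp (-Real.log (2 / δ)) = δ / 2 := by
    rw [Real.exp_neg, Real.exp_log (by positivity), inv_div]
  have hup := card_le_sum_radVec_sub_trace P (abs_dotProduct_mulVec_le_specNorm P) hp0
    ht0 hD hbound
  have hlow := card_le_sum_radVec_sub_trace (M := M) (-P) (p := specNorm P) (t := t)
    (L := Real.log (2 / δ))
    (fun v => by simpa [neg_mulVec] using abs_dotProduct_mulVec_le_specNorm P v) hp0 ht0
    (by simpa using hD) (by simpa using hbound)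
  rw [hexp] at hup hlow
  have hcard : Nat.card {s : Fin M → Fin n → Bool // t ≤ |hutchinson P s - P.trace|} ≤
      Nat.card {s : Fin M → Fin n → Bool //
        M * t ≤ ∑ i, (radVec (s i) ⬝ᵥ (P *ᵥ radVec (s i)) - P.trace)} +
      Nat.card {s : Fin M → Fin n → Bool //
        M * t ≤ ∑ i, (radVec (s i) ⬝ᵥ (-P *ᵥ radVec (s i)) - (-P).trace)} := by
    simp only [Nat.card_eq_fintype_card]
    refine le_trans (Fintype.card_subtype_mono _ _ ?_) (Fintype.card_subtype_or _ _)
    intro s hs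
    have h1 : (M : ℝ) * (hutchinson P s - P.trace) =
        ∑ i, (radVec (s i) ⬝ᵥ (P *ᵥ radVec (s i)) - P.trace) := by
      rw [hutchinson, Finset.sum_sub_distrib]
      simp
      field_simp
    have h2 : ∑ i, (radVec (s i) ⬝ᵥ (-P *ᵥ radVec (s i)) - (-P).trace) =
        -∑ i, (radVec (s i) ⬝ᵥ (P *ᵥ radVec (s i)) - P.trace) := by
      rw [← Finset.sum_neg_distrib]
      refine Finset.sum_congr rfl fun i _ => ?_
      rw [neg_mulVec, dotProduct_neg, trace_neg]
      ring
    rw [h2, ← h1, ← mul_neg]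
    exact (le_abs.1 hs).imp (fun h => mul_le_mul_of_nonneg_left h hM0.le)
      (fun h => mul_le_mul_of_nonneg_left h hM0.le)
  calc _ ≤ _ := Nat.cast_le.2 hcard
    _ ≤ δ / 2 * 2 ^ (M * n) + δ / 2 * 2 ^ (M * n) := by
        rw [Nat.cast_add]
        exact add_le_add hup hlow
    _ = _ := by ring
end

section
/- Let A be a real m₁×n matrix, B a real m₂×n matrix, U an m₁×m₁ orthogonal matrix, X an n×n invertible matrix, and Σ_A an m₁×n matrix with (Σ_A)ᵢⱼ = 0 whenever i ≠ j, such that Uᵀ A X = Σ_A and Xᵀ(AᵀA + BᵀB)X = Iₙ. Let i be an index valid both as a row index of U and as a column index of X (i ≤ min(m₁, n)), let u_i denote the i-th column of U and x_i the i-th column of X. Then for every z ∈ ℝⁿ with x_iᵀ (AᵀA + BᵀB) z = 0, it holds that u_iᵀ (A z) = 0. -/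
open Matrix

/-- With `Uᵀ A X = Σ_A` diagonal (rectangular) and
`Xᵀ (AᵀA + BᵀB) X = I`, the matrix `A` maps the `H`-orthogonal complement of a
right generalized singular vector `x_i` into the orthogonal complement of the
corresponding left vector `u_i`: if `x_iᵀ (AᵀA + BᵀB) z = 0` then `u_iᵀ (A z) = 0`. -/
theorem left_vector_orthogonality {m₁ m₂ n : ℕ}
    (A : Matrix (Fin m₁) (Fin n) ℝ) (B : Matrix (Fin m₂) (Fin n) ℝ)
    (U : Matrix (Fin m₁) (Fin m₁) ℝ) (X : Matrix (Fin n) (Fin n) ℝ)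
    (SA : Matrix (Fin m₁) (Fin n) ℝ)
    (hU : Uᵀ * U = 1) (hX : IsUnit X)
    (hdiag : ∀ (i : Fin m₁) (j : Fin n), (i : ℕ) ≠ (j : ℕ) → SA i j = 0)
    (hA : Uᵀ * A * X = SA)
    (hXHX : Xᵀ * (Aᵀ * A + Bᵀ * B) * X = 1)
    (i : ℕ) (hi₁ : i < m₁) (hi₂ : i < n)
    (z : Fin n → ℝ)
    (hz : (fun j => X j ⟨i, hi₂⟩) ⬝ᵥ ((Aᵀ * A + Bᵀ * B) *ᵥ z) = 0) :
    (fun r => U r ⟨i, hi₁⟩) ⬝ᵥ (A *ᵥ z) = 0 := by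
  have hX_inv : X * (Xᵀ * (Aᵀ * A + Bᵀ * B)) = 1 := mul_eq_one_comm.mp hXHX
  have hUA : Uᵀ * A = SA * (Xᵀ * (Aᵀ * A + Bᵀ * B)) := by
    rw [← hA, Matrix.mul_assoc, hX_inv, Matrix.mul_one]
  change (Xᵀ *ᵥ ((Aᵀ * A + Bᵀ * B) *ᵥ z)) ⟨i, hi₂⟩ = 0 at hz
  change (Uᵀ *ᵥ (A *ᵥ z)) ⟨i, hi₁⟩ = 0
  rw [mulVec_mulVec] at hz
  rw [mulVec_mulVec, hUA, ← mulVec_mulVec, mulVec, dotProduct]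
  refine Finset.sum_eq_zero fun j _ => ?_
  by_cases hij : i = (j : ℕ)
  · obtain rfl : j = ⟨i, hi₂⟩ := Fin.ext hij.symm
    rw [hz, mul_zero]
  · rw [hdiag _ j hij, zero_mul]
end
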